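/- There exists a unique infinitely differentiable function ψ : (0,∞) → [0,∞) such that the sequence ψ_1, ψ_2, ψ_3, … converges to ψ uniformly on every compact subset of (0,∞). Moreover, this ψ satisfies ψ(4x) = (3/8)·ψ(x) for all x > 0. -/

import Mathlib

open MeasureTheory Filter

/-- Convolution of functions on `ℝ`. -/
noncomputable def rconv (f g : ℝ → ℝ) : ℝ → ℝ := fun x => ∫ y : ℝ, f y * g (x - y)

/-- The rescaling `φ_s(x) = 4^{-s} φ(4^{-s} x)`. -/
noncomputable def phis (φ : ℝ → ℝ) (s : ℤ) : ℝ → ℝ :=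
  fun x => (4 : ℝ) ^ (-s) * φ ((4 : ℝ) ^ (-s) * x)

/-- Convolution of the functions `φ_s` for `s` in a (nonempty) list. -/
noncomputable def convListR (f : ℤ → ℝ → ℝ) : List ℤ → ℝ → ℝ
  | [] => fun _ => 0
  | [s] => f s
  | s :: l => rconv (f s) (convListR f l)

/-- `φ_S`: the convolution of the functions `φ_s` for `s ∈ S`. -/
noncomputable def phiS (φ : ℝ → ℝ) (S : Finset ℤ) : ℝ → ℝ :=
  convListR (phis φ) (S.sort (· ≤ ·))

/-- `ψ_r = (3/2)^{-r} ψ_{[-r,r]}`, where `ψ_T` is the sum of `φ_S` over nonempty finite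
subsets `S` of `T ∩ ℤ`. -/
noncomputable def psiR (φ : ℝ → ℝ) (r : ℕ) : ℝ → ℝ := fun x =>
  (3 / 2 : ℝ) ^ (-(r : ℤ)) *
    ∑ S ∈ (Finset.Icc (-(r : ℤ)) (r : ℤ)).powerset.filter Finset.Nonempty, phiS φ S x


/-- Averaging against `φ` at scale `ε`. -/
noncomputable def avgOp (φ : ℝ → ℝ) (ε : ℝ) (h : ℝ → ℝ) : ℝ → ℝ :=
  fun x => ∫ z : ℝ, φ z * h (x - ε * z)

/-- The normalised operator `(2/3)(1 + avg)`. -/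
noncomputable def topOp (φ : ℝ → ℝ) (ε : ℝ) (h : ℝ → ℝ) : ℝ → ℝ :=
  fun x => (2 / 3 : ℝ) * (h x + avgOp φ ε h x)

/-- Iterates of the operators at scales `4⁻¹, 4⁻², …`. -/
noncomputable def iterOp (φ : ℝ → ℝ) (f : ℝ → ℝ) : ℕ → ℝ → ℝ
  | 0 => f
  | n + 1 => topOp φ ((1 / 4 : ℝ) ^ (n + 1)) (iterOp φ f n)

theorem rconv_phis (φ h : ℝ → ℝ) (s : ℤ) (x : ℝ) :
    rconv (phis φ s) h x = avgOp φ ((4 : ℝ) ^ s) h x := by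
  have hpos : (0 : ℝ) < (4 : ℝ) ^ s := by positivity
  have := Measure.integral_comp_mul_left (fun z => φ z * h (x - (4 : ℝ) ^ s * z)) ((4 : ℝ) ^ (-s))
  unfold rconv avgOp phis
  have h2 : ∀ y : ℝ, (4 : ℝ) ^ (-s) * φ ((4 : ℝ) ^ (-s) * y) * h (x - y)
      = (4 : ℝ) ^ (-s) * (φ ((4 : ℝ) ^ (-s) * y) * h (x - (4 : ℝ) ^ s * ((4 : ℝ) ^ (-s) * y))) := by
    intro y
    rw [← mul_assoc ((4 : ℝ) ^ s), zpow_neg, mul_inv_cancel₀ hpos.ne', one_mul]; ring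
  simp_rw [h2]
  rw [integral_const_mul, this, zpow_neg, inv_inv, abs_of_pos hpos, smul_eq_mul, ← mul_assoc,
    inv_mul_cancel₀ hpos.ne', one_mul]

/-- Continuous and bounded. -/
def Good (h : ℝ → ℝ) : Prop := Continuous h ∧ ∃ C, ∀ x, |h x| ≤ C

theorem schwartz_weight (f : SchwartzMap ℝ ℝ) (N : ℕ) :
    ∃ q : ℝ, 0 ≤ q ∧ ∀ x, |f x| * (1 + |x|) ^ N ≤ q := by
  have := fun x => SchwartzMap.one_add_le_sup_seminorm_apply (𝕜 := ℝ) (m := (N, 0)) (k := N) (n := 0)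
    le_rfl le_rfl f x
  refine ⟨_, le_trans (by positivity) (this 0), fun x => ?_⟩
  have h := this x
  rw [norm_iteratedFDeriv_zero, mul_comm] at h
  exact h

theorem schwartz_int (f : SchwartzMap ℝ ℝ) (N : ℕ) :
    Integrable (fun z => f z * (1 + |z|) ^ N) := by
  obtain ⟨q, hq, h⟩ := schwartz_weight f (N + 2)
  refine (integrable_inv_one_add_sq.const_mul q).mono' ?_ ?_
  · exact (f.continuous.mul (by fun_prop)).aestronglyMeasurable
  · refine Eventually.of_forall fun x => ?_
    rw [Real.norm_eq_abs, abs_mul, abs_of_nonneg (a := (1 + |x|) ^ N) (by positivity),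
      ← div_eq_mul_inv, le_div_iff₀ (by positivity)]
    refine le_trans ?_ (h x)
    rw [pow_add, ← mul_assoc]
    gcongr
    nlinarith [abs_nonneg x, sq_abs x]

section
variable (φ : SchwartzMap ℝ ℝ)

theorem schwartz_integrable : Integrable (fun z => φ z) := by
  simpa using schwartz_int φ 0

theorem avg_integrable {h : ℝ → ℝ} (hg : Good h) (ε x : ℝ) :
    Integrable (fun z => φ z * h (x - ε * z)) := by
  obtain ⟨hc, C, hC⟩ := hg
  refine ((schwartz_integrable φ).norm.const_mul C).mono' ?_ ?_
  · exact (φ.continuous.mul (by fun_prop)).aestronglyMeasurable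
  · refine Eventually.of_forall fun z => ?_
    rw [norm_mul, mul_comm]
    gcongr
    exact hC _

theorem avg_good {h : ℝ → ℝ} (hg : Good h) (ε : ℝ) : Good (avgOp φ ε h) := by
  obtain ⟨hc, C, hC⟩ := id hg
  have key : ∀ x z, ‖φ z * h (x - ε * z)‖ ≤ C * ‖φ z‖ := by
    intro x z
    rw [norm_mul, mul_comm]
    gcongr
    exact hC _
  have hint := (schwartz_integrable φ).norm.const_mul C
  refine ⟨?_, ∫ z, C * ‖φ z‖, fun x => ?_⟩
  · refine continuous_of_dominated (bound := fun z => C * ‖φ z‖) ?_ ?_ hint ?_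
    · intro x
      exact (avg_integrable φ hg ε x).aestronglyMeasurable
    · intro x
      exact Eventually.of_forall (key x)
    · exact Eventually.of_forall fun z => by fun_prop
  · exact norm_integral_le_of_norm_le hint (Eventually.of_forall (key x))

theorem top_good {h : ℝ → ℝ} (hg : Good h) (ε : ℝ) : Good (topOp φ ε h) := by
  obtain ⟨hc', C', hC'⟩ := avg_good φ hg ε
  obtain ⟨hc, C, hC⟩ := hg
  refine ⟨?_, (2 / 3) * (C + C'), fun x => ?_⟩
  · unfold topOp; fun_prop
  · unfold topOp
    rw [abs_mul, abs_of_pos (by norm_num : (0 : ℝ) < 2 / 3)]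
    gcongr
    exact (abs_add_le _ _).trans (add_le_add (hC x) (hC' x))

theorem iter_good {f : ℝ → ℝ} (hf : Good f) (n : ℕ) : Good (iterOp φ f n) := by
  induction n with
  | zero => exact hf
  | succ n ih => exact top_good φ ih _

theorem schwartz_good (f : SchwartzMap ℝ ℝ) : Good f := by
  obtain ⟨q, -, h⟩ := schwartz_weight f 0
  exact ⟨f.continuous, q, fun x => by simpa using h x⟩

theorem top_hasDeriv {h h' : ℝ → ℝ} (hg : Good h) (hg' : Good h')
    (hd : ∀ x, HasDerivAt h (h' x) x) (ε x : ℝ) :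
    HasDerivAt (topOp φ ε h) (topOp φ ε h' x) x := by
  have := hasDerivAt_integral_of_dominated_loc_of_deriv_le (μ := volume) (𝕜 := ℝ)
    (F := fun x z => φ z * h (x - ε * z)) (F' := fun x z => φ z * h' (x - ε * z)) (x₀ := x)
    (bound := fun z => hg'.2.choose * ‖φ z‖) (s := Set.univ) Filter.univ_mem
    (Eventually.of_forall fun y => (avg_integrable φ hg ε y).aestronglyMeasurable)
    (avg_integrable φ hg ε x) (avg_integrable φ hg' ε x).aestronglyMeasurable
    (Eventually.of_forall fun z y _ => ?_)
    ((schwartz_integrable φ).norm.const_mul _) (Eventually.of_forall fun z y _ => ?_)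
  · exact ((hd x).add this.2).const_mul _
  · rw [norm_mul, mul_comm]
    gcongr
    exact hg'.2.choose_spec _
  · have := (hd (y - ε * z)).comp y ((hasDerivAt_id y).sub_const (ε * z))
    simpa using this.const_mul (φ z)

theorem iter_hasDeriv (f : SchwartzMap ℝ ℝ) (n : ℕ) (x : ℝ) :
    HasDerivAt (iterOp φ f n) (iterOp φ (SchwartzMap.derivCLM ℝ ℝ f) n x) x := by
  induction n generalizing x with
  | zero =>
    simp only [iterOp, SchwartzMap.derivCLM_apply]
    exact f.differentiableAt.hasDerivAt
  | succ n ih =>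
    exact top_hasDeriv φ (iter_good φ (schwartz_good f) n)
      (iter_good φ (schwartz_good (SchwartzMap.derivCLM ℝ ℝ f)) n) ih _ x

theorem iter_nonneg (hnonneg : ∀ x, 0 ≤ φ x) {f : ℝ → ℝ} (hf : ∀ x, 0 ≤ f x) (n : ℕ) (x : ℝ) : 0 ≤ iterOp φ f n x := by
  induction n generalizing x with
  | zero => exact hf x
  | succ n ih =>
    have : 0 ≤ avgOp φ ((1 / 4 : ℝ) ^ (n + 1)) (iterOp φ f n) x :=
      integral_nonneg fun z => mul_nonneg (hnonneg z) (ih _)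
    have := ih x
    simp only [iterOp, topOp]
    positivity

theorem top_weight (hnonneg : ∀ x, 0 ≤ φ x) (hone : ∫ x : ℝ, φ x = 1 / 2)
    {h : ℝ → ℝ} {q : ℝ} (N : ℕ) (hh : ∀ x, |h x| * (1 + |x|) ^ N ≤ q)
    {ε : ℝ} (h0 : 0 ≤ ε) (h1 : ε ≤ 1) (x : ℝ) :
    |topOp φ ε h x| * (1 + |x|) ^ N ≤ q * (1 + (∫ z, φ z * (1 + |z|) ^ N) * ε) := by
  have hq : 0 ≤ q := le_trans (by positivity) (hh 0)
  set C := ∫ z, φ z * (1 + |z|) ^ N with hC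
  have hCpos : 0 ≤ C := integral_nonneg fun z => mul_nonneg (hnonneg z) (by positivity)
  have hb : |avgOp φ ε h x * (1 + |x|) ^ N| ≤ q * (1 / 2 + ε * C) := by
    have e : q * (1 / 2 + ε * C) = ∫ z, q * (φ z + ε * (φ z * (1 + |z|) ^ N)) := by
      rw [integral_const_mul, integral_add (schwartz_integrable φ)
        ((schwartz_int φ N).const_mul ε), integral_const_mul, hone]
    rw [e]
    unfold avgOp
    rw [← integral_mul_const, ← Real.norm_eq_abs]
    refine norm_integral_le_of_norm_le (((schwartz_integrable φ).add
      ((schwartz_int φ N).const_mul ε)).const_mul q) (Eventually.of_forall fun z => ?_)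
    rw [Real.norm_eq_abs, abs_mul, abs_mul, abs_of_nonneg (hnonneg z),
      abs_of_nonneg (a := (1 + |x|) ^ N) (by positivity)]
    have k1 : (1 + |x|) ^ N ≤ (1 + |x - ε * z|) ^ N * (1 + ε * |z|) ^ N := by
      rw [← mul_pow]
      gcongr
      have : |x| ≤ |x - ε * z| + ε * |z| := by
        calc |x| = |(x - ε * z) + ε * z| := by ring_nf
          _ ≤ |x - ε * z| + |ε * z| := abs_add_le _ _
          _ = _ := by rw [abs_mul, abs_of_nonneg h0]
      have : 0 ≤ |x - ε * z| * (ε * |z|) := by positivity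
      nlinarith
    have k2 : (1 + ε * |z|) ^ N ≤ 1 + ε * (1 + |z|) ^ N := by
      have := (convexOn_pow N).2 (x := (1 : ℝ)) (by simp) (y := 1 + |z|)
        (by simp; positivity) (sub_nonneg.2 h1) h0 (by ring)
      simp only [smul_eq_mul, one_pow, mul_one] at this
      have e2 : (1 - ε) + ε * (1 + |z|) = 1 + ε * |z| := by ring
      rw [e2] at this
      linarith
    calc φ z * |h (x - ε * z)| * (1 + |x|) ^ N
        ≤ φ z * |h (x - ε * z)| * ((1 + |x - ε * z|) ^ N * (1 + ε * |z|) ^ N) := by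
          have := hnonneg z
          gcongr
      _ = φ z * (|h (x - ε * z)| * (1 + |x - ε * z|) ^ N) * (1 + ε * |z|) ^ N := by ring
      _ ≤ φ z * q * (1 + ε * (1 + |z|) ^ N) := by
          have := hnonneg z
          gcongr
          exact hh _
      _ = _ := by ring
  have : |topOp φ ε h x| * (1 + |x|) ^ N
      ≤ (2 / 3) * (|h x| * (1 + |x|) ^ N + |avgOp φ ε h x * (1 + |x|) ^ N|) := by
    unfold topOp
    rw [abs_mul, abs_of_pos (by norm_num : (0 : ℝ) < 2 / 3), abs_mul (avgOp φ ε h x),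
      abs_of_nonneg (a := (1 + |x|) ^ N) (by positivity), mul_assoc, ← add_mul]
    gcongr
    exact abs_add_le _ _
  have hx := hh x
  have : 0 ≤ q * (ε * C) := by positivity
  nlinarith

theorem iter_weight (hnonneg : ∀ x, 0 ≤ φ x) (hone : ∫ x : ℝ, φ x = 1 / 2)
    (f : SchwartzMap ℝ ℝ) (N : ℕ) :
    ∃ q : ℝ, 0 ≤ q ∧ ∀ n x, |iterOp φ f n x| * (1 + |x|) ^ N ≤ q := by
  obtain ⟨q, hq, hf⟩ := schwartz_weight f N
  set C := ∫ z, φ z * (1 + |z|) ^ N with hC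
  have hCpos : 0 ≤ C := integral_nonneg fun z => mul_nonneg (hnonneg z) (by positivity)
  have key : ∀ n : ℕ, ∀ x, |iterOp φ f n x| * (1 + |x|) ^ N
      ≤ q * Real.exp (C * (1 - (1 / 4 : ℝ) ^ n)) := by
    intro n
    induction n with
    | zero => simpa [iterOp] using hf
    | succ n ih =>
      intro x
      refine (top_weight φ hnonneg hone N ih (ε := (1 / 4 : ℝ) ^ (n + 1)) (by positivity)
        (pow_le_one₀ (by norm_num) (by norm_num)) x).trans ?_
      rw [← hC, mul_assoc]
      gcongr
      calc _ ≤ Real.exp (C * (1 - (1 / 4 : ℝ) ^ n)) * Real.exp (C * (1 / 4 : ℝ) ^ (n + 1)) := by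
            gcongr
            rw [add_comm]
            exact Real.add_one_le_exp _
        _ ≤ _ := by
            rw [← Real.exp_add]
            gcongr
            rw [← mul_add]
            gcongr
            have : (0 : ℝ) < (1 / 4 : ℝ) ^ n := by positivity
            rw [pow_succ]
            linarith
  refine ⟨q * Real.exp C, by positivity, fun n x => (key n x).trans ?_⟩
  gcongr
  have : (0 : ℝ) < (1 / 4 : ℝ) ^ n := by positivity
  nlinarith

theorem top_diff (hnonneg : ∀ x, 0 ≤ φ x) (hone : ∫ x : ℝ, φ x = 1 / 2)
    {h h' : ℝ → ℝ} {L : ℝ} (hg : Good h)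
    (hd : ∀ x, HasDerivAt h (h' x) x) (hL : ∀ x, |h' x| ≤ L) {ε : ℝ} (h0 : 0 ≤ ε) (x : ℝ) :
    |topOp φ ε h x - h x| ≤ L * (∫ z, φ z * (1 + |z|) ^ 1) * ε := by
  have hL0 : 0 ≤ L := (abs_nonneg _).trans (hL 0)
  have e : topOp φ ε h x - h x = (2 / 3) * ∫ z, (φ z * h (x - ε * z) - φ z * h x) := by
    rw [integral_sub (avg_integrable φ hg ε x) ((schwartz_integrable φ).mul_const _),
      integral_mul_const, hone]
    unfold topOp avgOp
    ring
  have hb : |∫ z, (φ z * h (x - ε * z) - φ z * h x)| ≤ ∫ z, (L * ε) * (φ z * (1 + |z|) ^ 1) := by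
    rw [← Real.norm_eq_abs]
    refine norm_integral_le_of_norm_le ((schwartz_int φ 1).const_mul _)
      (Eventually.of_forall fun z => ?_)
    have lip : |h (x - ε * z) - h x| ≤ L * |(x - ε * z) - x| :=
      convex_univ.norm_image_sub_le_of_norm_hasDerivWithin_le
        (fun y _ => (hd y).hasDerivWithinAt) (fun y _ => hL y) (Set.mem_univ _) (Set.mem_univ _)
    have e3 : |(x - ε * z) - x| = ε * |z| := by
      rw [show (x - ε * z) - x = -(ε * z) by ring, abs_neg, abs_mul, abs_of_nonneg h0]
    rw [e3] at lip
    rw [← mul_sub, Real.norm_eq_abs, abs_mul, abs_of_nonneg (hnonneg z)]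
    have := hnonneg z
    calc φ z * |h (x - ε * z) - h x| ≤ φ z * (L * (ε * (1 + |z|))) := by
          gcongr
          refine lip.trans ?_
          gcongr
          linarith
      _ = _ := by ring
  rw [integral_const_mul] at hb
  rw [e, abs_mul, abs_of_pos (by norm_num : (0 : ℝ) < 2 / 3)]
  have := abs_nonneg (∫ z, (φ z * h (x - ε * z) - φ z * h x))
  nlinarith

theorem iter_limit (hnonneg : ∀ x, 0 ≤ φ x) (hone : ∫ x : ℝ, φ x = 1 / 2)
    (f : SchwartzMap ℝ ℝ) :
    ∃ g : ℝ → ℝ, ∃ C : ℝ, 0 ≤ C ∧ ∀ n x, |iterOp φ f n x - g x| ≤ C * (1 / 4 : ℝ) ^ n := by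
  obtain ⟨L, hL0, hL⟩ := iter_weight φ hnonneg hone (SchwartzMap.derivCLM ℝ ℝ f) 0
  set M := ∫ z, φ z * (1 + |z|) ^ 1 with hM
  have hMpos : 0 ≤ M := integral_nonneg fun z => mul_nonneg (hnonneg z) (by positivity)
  have step : ∀ x n, dist (iterOp φ f n x) (iterOp φ f (n + 1) x) ≤ (L * M) * (1 / 4 : ℝ) ^ n := by
    intro x n
    rw [dist_comm, Real.dist_eq]
    refine (top_diff φ hnonneg hone (iter_good φ (schwartz_good f) n) (iter_hasDeriv φ f n)
      (L := L) (fun y => by simpa using hL n y) (by positivity) x).trans ?_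
    rw [← hM]
    gcongr ?_ * ?_
    exact pow_le_pow_of_le_one (by norm_num) (by norm_num) (Nat.le_succ n)
  choose g hg using fun x => cauchySeq_tendsto_of_complete
    (cauchySeq_of_le_geometric _ _ (by norm_num) (step x))
  refine ⟨g, L * M / (1 - 1 / 4), by norm_num; positivity, fun n x => ?_⟩
  have := dist_le_of_le_geometric_of_tendsto _ _ (by norm_num) (step x) (hg x) n
  rw [Real.dist_eq] at this
  refine this.trans (le_of_eq (by ring))

end

theorem phis_good (φ : SchwartzMap ℝ ℝ) (s : ℤ) : Good (phis (fun y => φ y) s) := by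
  obtain ⟨hc, C, hC⟩ := schwartz_good φ
  refine ⟨?_, (4 : ℝ) ^ (-s) * C, fun x => ?_⟩
  · unfold phis
    exact continuous_const.mul (hc.comp (by fun_prop))
  · unfold phis
    rw [abs_mul, abs_of_pos (by positivity : (0 : ℝ) < (4 : ℝ) ^ (-s))]
    gcongr
    exact hC _

theorem convList_good (φ : SchwartzMap ℝ ℝ) (l : List ℤ) :
    Good (convListR (phis (fun y => φ y)) l) := by
  induction l with
  | nil => exact ⟨continuous_const, 0, fun x => by simp [convListR]⟩
  | cons s l ih =>
    cases l with
    | nil => exact phis_good φ s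
    | cons t l =>
      have : convListR (phis (fun y => φ y)) (s :: t :: l)
          = avgOp φ ((4 : ℝ) ^ s) (convListR (phis (fun y => φ y)) (t :: l)) := by
        funext x
        exact rconv_phis _ _ _ _
      rw [this]
      exact avg_good φ ih _

theorem phiS_insert (φ : SchwartzMap ℝ ℝ) (t : Finset ℤ) (a : ℤ) (h : ∀ b ∈ t, a < b) (x : ℝ) :
    phiS (fun y => φ y) (insert a t) x = (if t = ∅ then phis (fun y => φ y) a x else 0) +
      avgOp φ ((4 : ℝ) ^ a) (phiS (fun y => φ y) t) x := by
  have h2 : a ∉ t := fun ha => lt_irrefl _ (h a ha)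
  unfold phiS
  rw [Finset.sort_insert _ (fun b hb => (h b hb).le) h2]
  by_cases ht : t = ∅
  · subst ht
    simp [convListR, avgOp]
  · rw [if_neg ht, zero_add]
    cases hl : t.sort (· ≤ ·) with
    | nil =>
      exfalso
      apply ht
      have := Finset.sort_toFinset t (· ≤ ·)
      rw [hl] at this
      simpa using this.symm
    | cons b l => exact rconv_phis _ _ _ _

theorem avg_sum (φ : SchwartzMap ℝ ℝ) {ι : Type*} (s : Finset ι) (h : ι → ℝ → ℝ)
    (hg : ∀ i ∈ s, Good (h i)) (ε x : ℝ) :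
    ∑ i ∈ s, avgOp φ ε (h i) x = avgOp φ ε (fun y => ∑ i ∈ s, h i y) x := by
  unfold avgOp
  rw [← integral_finsetSum]
  · simp_rw [Finset.mul_sum]
  · intro i hi
    exact avg_integrable φ (hg i hi) ε x

theorem scaled_good (φ : SchwartzMap ℝ ℝ) (n : ℕ) (c m : ℝ) :
    Good (fun y => c * iterOp φ φ n (m * y)) := by
  obtain ⟨hc, C, hC⟩ := iter_good φ (schwartz_good φ) n
  refine ⟨continuous_const.mul (hc.comp (by fun_prop)), |c| * C, fun x => ?_⟩
  rw [abs_mul]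
  gcongr
  exact hC _

theorem scaled_step (φ : SchwartzMap ℝ ℝ) (n : ℕ) (c : ℝ) (k m : ℤ) (hn : (n : ℤ) = m - k)
    (x : ℝ) :
    c * iterOp φ φ n ((4 : ℝ) ^ (-m) * x) +
      avgOp φ ((4 : ℝ) ^ (k - 1)) (fun y => c * iterOp φ φ n ((4 : ℝ) ^ (-m) * y)) x =
    (3 / 2) * c * iterOp φ φ (n + 1) ((4 : ℝ) ^ (-m) * x) := by
  have h4 : (4 : ℝ) ^ (-m) * (4 : ℝ) ^ (k - 1) = (1 / 4 : ℝ) ^ (n + 1) := by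
    rw [← zpow_add₀ (by norm_num), one_div, inv_pow, ← zpow_natCast, ← zpow_neg]
    congr 1
    push_cast
    omega
  have : avgOp φ ((4 : ℝ) ^ (k - 1)) (fun y => c * iterOp φ φ n ((4 : ℝ) ^ (-m) * y)) x
      = c * avgOp φ ((1 / 4 : ℝ) ^ (n + 1)) (iterOp φ φ n) ((4 : ℝ) ^ (-m) * x) := by
    unfold avgOp
    rw [← integral_const_mul]
    congr 1
    funext z
    beta_reduce
    rw [mul_sub ((4 : ℝ) ^ (-m)), ← mul_assoc ((4 : ℝ) ^ (-m)), h4]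
    ring
  rw [this]
  simp only [iterOp, topOp]
  ring

theorem sum_phiS (φ : SchwartzMap ℝ ℝ) (r : ℤ) (j : ℕ) (x : ℝ) :
    ∑ S ∈ (Finset.Icc (r + 1 - j) r).powerset, phiS (fun y => φ y) S x =
      ∑ m ∈ Finset.Icc (r + 1 - j) r,
        ((3 / 2 : ℝ) ^ (m - (r + 1 - j)).toNat * (4 : ℝ) ^ (-m)) *
          iterOp φ φ (m - (r + 1 - j)).toNat ((4 : ℝ) ^ (-m) * x) := by
  induction j generalizing x with
  | zero => simp [phiS, convListR]
  | succ j ih =>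
    set k : ℤ := r + 1 - j with hk
    have e1 : r + 1 - ((j + 1 : ℕ) : ℤ) = k - 1 := by push_cast; omega
    have e2 : Finset.Icc (k - 1) r = insert (k - 1) (Finset.Icc k r) := by
      ext y; simp only [Finset.mem_Icc, Finset.mem_insert]; omega
    have hnot : k - 1 ∉ Finset.Icc k r := by simp
    rw [e1, e2, Finset.sum_powerset_insert hnot, Finset.sum_insert hnot, ih x]
    have e3 : ∑ t ∈ (Finset.Icc k r).powerset, phiS (fun y => φ y) (insert (k - 1) t) x
        = phis (fun y => φ y) (k - 1) x + ∑ m ∈ Finset.Icc k r,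
          avgOp φ ((4 : ℝ) ^ (k - 1)) (fun y => ((3 / 2 : ℝ) ^ (m - k).toNat * (4 : ℝ) ^ (-m)) *
          iterOp φ φ (m - k).toNat ((4 : ℝ) ^ (-m) * y)) x := by
      rw [avg_sum φ _ _ (fun m _ => scaled_good φ _ _ _)]
      simp_rw [← ih]
      rw [← avg_sum φ _ (fun t => phiS (fun y => φ y) t) (fun t _ => convList_good φ _)]
      rw [Finset.sum_congr rfl (fun t ht => phiS_insert φ t (k - 1) (fun b hb => by
        have := Finset.mem_Icc.1 (Finset.mem_powerset.1 ht hb); omega) x)]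
      rw [Finset.sum_add_distrib, Finset.sum_ite_eq' _ ∅ (fun _ => phis (fun y => φ y) (k - 1) x)]
      simp
    rw [e3, add_left_comm, ← Finset.sum_add_distrib]
    congr 1
    · simp [phis, iterOp]
    · refine Finset.sum_congr rfl fun m hm => ?_
      have hm' := Finset.mem_Icc.1 hm
      rw [scaled_step φ _ _ k m (by omega)]
      have : (m - (k - 1)).toNat = (m - k).toNat + 1 := by omega
      rw [this, pow_succ]
      ring

theorem psiR_eq (φ : SchwartzMap ℝ ℝ) (r : ℕ) (x : ℝ) :
    psiR (fun y => φ y) r x = ∑ m ∈ Finset.Icc (-(r : ℤ)) r,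
      (3 / 8 : ℝ) ^ m * iterOp φ φ (m + r).toNat ((4 : ℝ) ^ (-m) * x) := by
  unfold psiR
  have h0 : ∑ S ∈ (Finset.Icc (-(r : ℤ)) (r : ℤ)).powerset.filter Finset.Nonempty,
      phiS (fun y => φ y) S x
      = ∑ S ∈ (Finset.Icc (-(r : ℤ)) (r : ℤ)).powerset, phiS (fun y => φ y) S x := by
    refine Finset.sum_subset (Finset.filter_subset _ _) fun S hS hn => ?_
    have : S = ∅ := by
      by_contra hne
      exact hn (Finset.mem_filter.2 ⟨hS, Finset.nonempty_iff_ne_empty.2 hne⟩)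
    subst this
    simp [phiS, convListR]
  have e : (r : ℤ) + 1 - ((2 * r + 1 : ℕ) : ℤ) = -(r : ℤ) := by push_cast; ring
  have h1 := sum_phiS φ r (2 * r + 1) x
  rw [e] at h1
  rw [h0, h1, Finset.mul_sum]
  refine Finset.sum_congr rfl fun m hm => ?_
  have hm' := Finset.mem_Icc.1 hm
  rw [sub_neg_eq_add, ← mul_assoc]
  congr 1
  have h2 : (((m + r).toNat : ℕ) : ℤ) = m + r := Int.toNat_of_nonneg (by omega)
  have h3 : (3 / 8 : ℝ) ^ m = (3 / 2) ^ m / 4 ^ m := by rw [← div_zpow]; norm_num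
  rw [← zpow_natCast, h2, zpow_add₀ (by norm_num), zpow_neg, zpow_neg, h3]
  field_simp

theorem summable_natAbs (K : ℝ) : Summable fun m : ℤ => K * (2 / 3 : ℝ) ^ m.natAbs := by
  refine Summable.mul_left _ (Summable.of_nat_of_neg ?_ ?_) <;>
  · simp only [Int.natAbs_natCast, Int.natAbs_neg]
    exact summable_geometric_of_lt_one (by norm_num) (by norm_num)

theorem term_bound {a x q v : ℝ} (ha : 0 < a) (hx : a ≤ x) (k : ℕ) (m : ℤ)
    (hv : |v| * (1 + |(4 : ℝ) ^ (-m) * x|) ^ (k + 1) ≤ q) :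
    |(3 / 8 : ℝ) ^ m * ((4 : ℝ) ^ (-m)) ^ k * v| ≤
      q * (1 + (a⁻¹) ^ (k + 1)) * (2 / 3 : ℝ) ^ m.natAbs := by
  have hq : 0 ≤ q := le_trans (by positivity) hv
  have hv0 : |v| ≤ q := le_trans (le_mul_of_one_le_right (abs_nonneg _)
    (one_le_pow₀ (by linarith [abs_nonneg ((4 : ℝ) ^ (-m) * x)]))) hv
  rw [abs_mul, abs_of_pos (by positivity : (0 : ℝ) < (3 / 8 : ℝ) ^ m * ((4 : ℝ) ^ (-m)) ^ k)]
  obtain ⟨n, rfl | rfl⟩ := m.eq_nat_or_neg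
  · rw [Int.natAbs_natCast, zpow_natCast, zpow_neg, zpow_natCast]
    have h1 : (((4 : ℝ) ^ n)⁻¹) ^ k ≤ 1 :=
      pow_le_one₀ (by positivity) (inv_le_one_of_one_le₀ (one_le_pow₀ (by norm_num)))
    have h2 : (3 / 8 : ℝ) ^ n ≤ (2 / 3) ^ n := pow_le_pow_left₀ (by norm_num) (by norm_num) n
    calc _ ≤ (2 / 3 : ℝ) ^ n * 1 * q := by gcongr
      _ = q * 1 * (2 / 3 : ℝ) ^ n := by ring
      _ ≤ _ := by
        gcongr
        have : 0 < (a⁻¹) ^ (k + 1) := by positivity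
        linarith
  · rw [neg_neg] at *
    rw [Int.natAbs_neg, Int.natAbs_natCast, zpow_natCast, zpow_neg, zpow_natCast]
    rw [zpow_natCast] at hv
    have h1 : |v| * ((4 : ℝ) ^ n * a) ^ (k + 1) ≤ q := by
      refine le_trans ?_ hv
      gcongr
      rw [abs_of_nonneg (mul_nonneg (by positivity) (ha.le.trans hx))]
      have : (4 : ℝ) ^ n * a ≤ (4 : ℝ) ^ n * x := by gcongr
      linarith
    have h2 : |v| * ((4 : ℝ) ^ n) ^ (k + 1) ≤ q * (a⁻¹) ^ (k + 1) := by
      rw [inv_pow, ← div_eq_mul_inv, le_div_iff₀ (by positivity), mul_assoc, ← mul_pow]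
      exact h1
    have h3 : ((3 / 8 : ℝ) ^ n)⁻¹ = (2 / 3) ^ n * 4 ^ n := by
      rw [← inv_pow, ← mul_pow]; norm_num
    rw [h3]
    calc (2 / 3 : ℝ) ^ n * 4 ^ n * (4 ^ n) ^ k * |v|
        = (2 / 3 : ℝ) ^ n * (|v| * ((4 : ℝ) ^ n) ^ (k + 1)) := by ring
      _ ≤ (2 / 3 : ℝ) ^ n * (q * (a⁻¹) ^ (k + 1)) := by gcongr
      _ = q * (0 + (a⁻¹) ^ (k + 1)) * (2 / 3 : ℝ) ^ n := by ring
      _ ≤ _ := by gcongr; norm_num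

theorem contDiffOn_of_chain (s : Set ℝ) (hs : IsOpen s) (F : ℕ → ℝ → ℝ)
    (h : ∀ k, ∀ x ∈ s, HasDerivAt (F k) (F (k + 1) x) x) :
    ContDiffOn ℝ (⊤ : ℕ∞) (F 0) s := by
  have key : ∀ n : ℕ, ∀ k, ContDiffOn ℝ n (F k) s := by
    intro n
    induction n with
    | zero =>
      intro k
      rw [Nat.cast_zero, contDiffOn_zero]
      exact fun x hx => (h k x hx).continuousAt.continuousWithinAt
    | succ n ih =>
      intro k
      push_cast
      rw [contDiffOn_succ_iff_deriv_of_isOpen hs]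
      refine ⟨fun x hx => (h k x hx).differentiableAt.differentiableWithinAt, by simp, ?_⟩
      exact (ih (k + 1)).congr fun x hx => (h k x hx).deriv
  exact contDiffOn_infty.2 fun n => key n 0

theorem psi_exists_unique (φ : SchwartzMap ℝ ℝ)
    (hnonneg : ∀ x, 0 ≤ φ x)
    (hsupp : ∀ x : ℝ, x ≤ 0 → φ x = 0)
    (hone : ∫ x : ℝ, φ x = 1 / 2) :
    ∃ ψ : ℝ → ℝ,
      ((∀ x : ℝ, 0 < x → 0 ≤ ψ x) ∧ ContDiffOn ℝ (⊤ : ℕ∞) ψ (Set.Ioi 0) ∧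
        (∀ K : Set ℝ, K ⊆ Set.Ioi 0 → IsCompact K →
          TendstoUniformlyOn (fun r : ℕ => psiR (fun y => φ y) r) ψ atTop K)) ∧
      (∀ ψ' : ℝ → ℝ,
        ((∀ x : ℝ, 0 < x → 0 ≤ ψ' x) ∧ ContDiffOn ℝ (⊤ : ℕ∞) ψ' (Set.Ioi 0) ∧
          (∀ K : Set ℝ, K ⊆ Set.Ioi 0 → IsCompact K →
            TendstoUniformlyOn (fun r : ℕ => psiR (fun y => φ y) r) ψ' atTop K)) →
        Set.EqOn ψ' ψ (Set.Ioi 0)) ∧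
      (∀ x : ℝ, 0 < x → ψ (4 * x) = (3 / 8) * ψ x) := by
  classical
  set f : ℕ → SchwartzMap ℝ ℝ := fun k => (SchwartzMap.derivCLM ℝ ℝ)^[k] φ with hf
  have hf0 : f 0 = φ := rfl
  have hfs : ∀ k, f (k + 1) = SchwartzMap.derivCLM ℝ ℝ (f k) := fun k =>
    Function.iterate_succ_apply' _ _ _
  choose g C hC0 hC using fun k => iter_limit φ hnonneg hone (f k)
  choose Q hQ0 hQ using fun k => iter_weight φ hnonneg hone (f k) (k + 1)
  have hzero : ∀ c : ℝ, Tendsto (fun n : ℕ => c * (1 / 4 : ℝ) ^ n) atTop (nhds 0) := fun c => by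
    simpa using (tendsto_pow_atTop_nhds_zero_of_lt_one (by norm_num : (0 : ℝ) ≤ 1 / 4)
      (by norm_num)).const_mul c
  have hlim : ∀ k x, Tendsto (fun n => iterOp φ (f k) n x) atTop (nhds (g k x)) := by
    intro k x
    rw [tendsto_iff_dist_tendsto_zero]
    exact squeeze_zero (fun _ => dist_nonneg) (fun n => hC k n x) (hzero (C k))
  have hgQ : ∀ k x, |g k x| * (1 + |x|) ^ (k + 1) ≤ Q k := fun k x =>
    le_of_tendsto ((hlim k x).abs.mul_const _) (Eventually.of_forall fun n => hQ k n x)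
  have hgd : ∀ k x, HasDerivAt (g k) (g (k + 1) x) x := by
    intro k x
    refine hasDerivAt_of_tendstoUniformly (l := atTop) (f := fun n => iterOp φ (f k) n)
      (f' := fun n => iterOp φ (f (k + 1)) n) ?_ (Eventually.of_forall fun n y => ?_) (hlim k) x
    · rw [Metric.tendstoUniformly_iff]
      intro ε hε
      filter_upwards [(hzero (C (k + 1))).eventually_lt_const hε] with n hn y
      rw [dist_comm]
      exact (hC (k + 1) n y).trans_lt hn
    · rw [hfs]
      exact iter_hasDeriv φ (f k) n y
  have hg0 : ∀ x, 0 ≤ g 0 x := fun x =>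
    ge_of_tendsto (hlim 0 x) (Eventually.of_forall fun n => iter_nonneg φ hnonneg hnonneg n x)
  -- the terms of the series
  set G : ℕ → ℤ → ℝ → ℝ := fun k m x =>
    (3 / 8 : ℝ) ^ m * ((4 : ℝ) ^ (-m)) ^ k * g k ((4 : ℝ) ^ (-m) * x) with hG
  have hGb : ∀ k m a x, 0 < a → a ≤ x → |G k m x| ≤
      Q k * (1 + (a⁻¹) ^ (k + 1)) * (2 / 3 : ℝ) ^ m.natAbs := fun k m a x ha hx =>
    term_bound ha hx k m (hgQ k _)
  have hGsum : ∀ k x, 0 < x → Summable fun m => G k m x := fun k x hx =>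
    Summable.of_norm_bounded (summable_natAbs _) (fun m => hGb k m x x hx le_rfl)
  have hGd : ∀ k m x, HasDerivAt (G k m) (G (k + 1) m x) x := by
    intro k m x
    have h1 : HasDerivAt (fun y : ℝ => (4 : ℝ) ^ (-m) * y) ((4 : ℝ) ^ (-m)) x := by
      simpa using (hasDerivAt_id x).const_mul ((4 : ℝ) ^ (-m))
    have h2 := ((hgd k ((4 : ℝ) ^ (-m) * x)).comp x h1).const_mul
      ((3 / 8 : ℝ) ^ m * ((4 : ℝ) ^ (-m)) ^ k)
    refine h2.congr_deriv ?_
    simp only [hG]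
    ring
  set Ψ : ℕ → ℝ → ℝ := fun k x => ∑' m : ℤ, G k m x with hΨ
  have hΨd : ∀ k, ∀ x ∈ Set.Ioi (0 : ℝ), HasDerivAt (Ψ k) (Ψ (k + 1) x) x := by
    intro k x hx
    have hx : 0 < x := hx
    have hm : x ∈ Set.Ioi (x / 2) := by simp only [Set.mem_Ioi]; linarith
    exact hasDerivAt_tsum_of_isPreconnected
      (summable_natAbs (Q (k + 1) * (1 + ((x / 2)⁻¹) ^ (k + 1 + 1)))) isOpen_Ioi isPreconnected_Ioi
      (fun m y _ => hGd k m y)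
      (fun m y hy => hGb (k + 1) m (x / 2) y (by linarith) (le_of_lt hy)) hm (hGsum k x hx) hm
  have hconv : ∀ K : Set ℝ, K ⊆ Set.Ioi 0 → IsCompact K →
      TendstoUniformlyOn (fun r : ℕ => psiR (fun y => φ y) r) (Ψ 0) atTop K := by
    intro K hK hKc
    rcases K.eq_empty_or_nonempty with rfl | hne
    · exact tendstoUniformlyOn_empty
    obtain ⟨a, haK, ha⟩ := hKc.exists_isLeast hne
    have ha0 : 0 < a := hK haK
    set B : ℝ := Q 0 * (1 + (a⁻¹) ^ (0 + 1)) with hB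
    set u : ℤ → ℝ := fun m => B * (2 / 3 : ℝ) ^ m.natAbs with hu
    have hus : Summable u := summable_natAbs _
    have hB0 : 0 ≤ B := mul_nonneg (hQ0 0) (by positivity)
    have hu0 : ∀ m, 0 ≤ u m := fun m => by positivity
    -- the approximating terms
    set A : ℕ → ℤ → ℝ → ℝ := fun r m x => if m ∈ Finset.Icc (-(r : ℤ)) r then
      (3 / 8 : ℝ) ^ m * iterOp φ φ (m + r).toNat ((4 : ℝ) ^ (-m) * x) else 0 with hA
    have hAb : ∀ r m, ∀ x ∈ K, |A r m x| ≤ u m := by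
      intro r m x hx
      simp only [hA]
      split_ifs with h
      · have := term_bound ha0 (ha hx) 0 m (hQ 0 (m + r).toNat ((4 : ℝ) ^ (-m) * x))
        rw [pow_zero, mul_one] at this
        exact this
      · simpa using hu0 m
    have hAsum : ∀ r, ∀ x ∈ K, Summable fun m => A r m x := fun r x hx =>
      Summable.of_norm_bounded hus (fun m => hAb r m x hx)
    have hpsi : ∀ r x, psiR (fun y => φ y) r x = ∑' m, A r m x := by
      intro r x
      rw [psiR_eq, tsum_eq_sum (s := Finset.Icc (-(r : ℤ)) r)]
      · exact Finset.sum_congr rfl fun m hm => by simp only [hA, if_pos hm]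
      · intro m hm
        simp only [hA, if_neg hm]
    set d : ℕ → ℤ → ℝ := fun r m => if m ∈ Finset.Icc (-(r : ℤ)) r then
      min (2 * u m) ((3 / 8 : ℝ) ^ m * (C 0 * (1 / 4 : ℝ) ^ (m + r).toNat)) else 2 * u m with hd
    have hd0 : ∀ r m, 0 ≤ d r m := by
      intro r m
      have h1 := hu0 m
      have h2 := hC0 0
      simp only [hd]
      split_ifs
      · exact le_min (by positivity) (by positivity)
      · positivity
    have hd2 : ∀ r m, d r m ≤ 2 * u m := by
      intro r m
      simp only [hd]
      split_ifs
      · exact min_le_left _ _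
      · exact le_rfl
    have hdsum : ∀ r, Summable (d r) := fun r =>
      Summable.of_nonneg_of_le (hd0 r) (hd2 r) (hus.mul_left 2)
    have hdiff : ∀ r m, ∀ x ∈ K, |G 0 m x - A r m x| ≤ d r m := by
      intro r m x hx
      have h2 : |G 0 m x - A r m x| ≤ 2 * u m := by
        have h3 := hGb 0 m a x ha0 (ha hx)
        have h4 := hAb r m x hx
        have h5 := abs_sub (G 0 m x) (A r m x)
        simp only [hu, hB] at h4 ⊢
        linarith
      simp only [hd]
      split_ifs with h
      · refine le_min h2 ?_
        simp only [hA, if_pos h, hG, pow_zero, mul_one]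
        rw [← mul_sub, abs_mul, abs_of_pos (by positivity : (0 : ℝ) < (3 / 8 : ℝ) ^ m), abs_sub_comm]
        gcongr
        exact hC 0 _ _
      · exact h2
    have hdlim : Tendsto (fun r => ∑' m, d r m) atTop (nhds 0) := by
      have := tendsto_tsum_of_dominated_convergence (f := d) (g := fun _ => (0 : ℝ)) (𝓕 := atTop)
        (bound := fun m => 2 * u m) (hus.mul_left 2) (fun m => ?_)
        (Eventually.of_forall fun r m => ?_)
      · simpa using this
      · have h1 : Tendsto (fun r : ℕ => (3 / 8 : ℝ) ^ m * (C 0 * (1 / 4 : ℝ) ^ (m + r).toNat))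
            atTop (nhds 0) := by
          have h2 : Tendsto (fun r : ℕ => (m + r).toNat) atTop atTop :=
            tendsto_atTop.2 fun b => by
              filter_upwards [eventually_ge_atTop (b + m.natAbs)] with r hr
              omega
          simpa using ((hzero (C 0)).comp h2).const_mul ((3 / 8 : ℝ) ^ m)
        refine squeeze_zero' (Eventually.of_forall fun r => hd0 r m) ?_ h1
        filter_upwards [eventually_ge_atTop m.natAbs] with r hr
        have : m ∈ Finset.Icc (-(r : ℤ)) r := by
          rw [Finset.mem_Icc]; omega
        simp only [hd, if_pos this]
        exact min_le_right _ _
      · rw [Real.norm_eq_abs, abs_of_nonneg (hd0 r m)]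
        exact hd2 r m
    rw [Metric.tendstoUniformlyOn_iff]
    intro ε hε
    filter_upwards [hdlim.eventually_lt_const hε] with r hr x hx
    refine lt_of_le_of_lt ?_ hr
    rw [hpsi, Real.dist_eq]
    simp only [hΨ]
    rw [← (hGsum 0 x (hK hx)).tsum_sub (hAsum r x hx)]
    rw [← Real.norm_eq_abs]
    exact tsum_of_norm_bounded (hdsum r).hasSum (fun m => hdiff r m x hx)
  refine ⟨Ψ 0, ⟨?_, contDiffOn_of_chain _ isOpen_Ioi Ψ hΨd, hconv⟩, ?_, ?_⟩
  · intro x hx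
    refine tsum_nonneg fun m => ?_
    have := hg0 ((4 : ℝ) ^ (-m) * x)
    simp only [hG]
    positivity
  · rintro ψ' ⟨-, -, h⟩ x hx
    have h1 := (h {x} (by simpa using hx) isCompact_singleton).tendsto_at (Set.mem_singleton x)
    have h2 := (hconv {x} (by simpa using hx) isCompact_singleton).tendsto_at (Set.mem_singleton x)
    exact tendsto_nhds_unique h1 h2
  · intro x hx
    simp only [hΨ]
    rw [← (Equiv.addRight (1 : ℤ)).tsum_eq (fun m => G 0 m (4 * x)), ← tsum_mul_left]
    refine tsum_congr fun m => ?_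
    simp only [hG, Equiv.coe_addRight, pow_zero, mul_one]
    have h1 : (4 : ℝ) ^ (-(m + 1)) * (4 * x) = (4 : ℝ) ^ (-m) * x := by
      rw [neg_add, zpow_add₀ (by norm_num)]
      norm_num
      ring
    rw [h1, zpow_add_one₀ (by norm_num)]
    ring
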